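/- arXiv:0810.4656 — 2 statements merged into one kernel-verified Lean document; each statement's English description precedes it below -/
import Mathlib

section
/- Let A be the monomial algebra on 13 generators defined below and K the trivial A-module. Then there exist classes β, γ ∈ Extᴬ²(K,K) whose Yoneda product βγ ∈ Extᴬ⁴(K,K) is nonzero. -/
/-!
Let `K` be a field and `V` a 13-dimensional `K`-vector space with basis
`{m,n,p,q,r,s,t,u,v,w,x,y,z}`.  Let `A = T(V)/I` be the quotient of the free
(tensor) algebra on `V` by the two-sided ideal generated by the nine monomials
`mn²p, n²pqr, npqrs, pqrst, stu, tuvwx, uvwxy, vwxy², xy²z`, and regard `K` as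
the trivial left `A`-module via the augmentation sending every generator to `0`.
-/

open CategoryTheory

/-- The thirteen generators `m,n,p,q,r,s,t,u,v,w,x,y,z` of the algebra `A`. -/
inductive Gen : Type
  | m | n | p | q | r | s | t | u | v | w | x | y | z

variable (K : Type) [Field K]

open Gen

/-- The generator `i`, as an element of the tensor algebra `T(V)`. -/
noncomputable def g (i : Gen) : FreeAlgebra K Gen := FreeAlgebra.ι K i

/-- The relation identifying each of the nine defining monomials with `0`;
the quotient of `T(V)` by this relation is exactly `T(V)/I` where `I` is the
two-sided ideal generated by the nine monomials. -/
inductive MonRel : FreeAlgebra K Gen → FreeAlgebra K Gen → Prop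
  | mnnp : MonRel (g K m * g K n * g K n * g K p) 0
  | nnpqr : MonRel (g K n * g K n * g K p * g K q * g K r) 0
  | npqrs : MonRel (g K n * g K p * g K q * g K r * g K s) 0
  | pqrst : MonRel (g K p * g K q * g K r * g K s * g K t) 0
  | stu : MonRel (g K s * g K t * g K u) 0
  | tuvwx : MonRel (g K t * g K u * g K v * g K w * g K x) 0
  | uvwxy : MonRel (g K u * g K v * g K w * g K x * g K y) 0
  | vwxyy : MonRel (g K v * g K w * g K x * g K y * g K y) 0
  | xyyz : MonRel (g K x * g K y * g K y * g K z) 0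

/-- The monomial algebra `A = T(V)/I`. -/
noncomputable abbrev A : Type := RingQuot (MonRel K)

/-- The augmentation `A →ₐ[K] K`, sending every generator to `0`. -/
noncomputable def aug : A K →ₐ[K] K :=
  RingQuot.liftAlgHom K ⟨FreeAlgebra.lift K (fun _ => (0 : K)), by
    rintro x y h
    induction h <;> simp [g]⟩

/-- `K`, regarded as the trivial left `A`-module via the augmentation. -/
noncomputable def KMod : ModuleCat.{0} (A K) :=
  letI : Module (A K) K := Module.compHom K (aug K).toRingHom
  ModuleCat.of (A K) K

noncomputable local instance instDC : HasDerivedCategory.{1} (ModuleCat.{0} (A K)) :=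
  HasDerivedCategory.standard _

local instance instHE : HasExt.{1} (ModuleCat.{0} (A K)) :=
  @hasExt_of_hasDerivedCategory.{1, 0, 1} (ModuleCat.{0} (A K)) _ _ (instDC K)

/-- The Ext group `Extᴬⁿ(K, K)`; the Yoneda product of `a : E K i` and
`b : E K j` is given by the composition `a.comp b : E K (i + j)`. -/
noncomputable abbrev E (n : ℕ) : Type 1 := Abelian.Ext (KMod K) (KMod K) n


section Abelian

universe w v u

open Abelian

variable {C : Type u} [Category.{v} C] [Abelian C] [HasExt.{w} C]

/-- Dimension shifting: composing with the class of a short exact sequence whose middle term is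
projective is injective in positive degrees. -/
lemma eq_zero_of_extClass_comp_eq_zero {S : ShortComplex C} (hS : S.ShortExact)
    [Projective S.X₂] {Y : C} {n m : ℕ} (x : Ext S.X₁ Y (n + 1)) (h : 1 + (n + 1) = m)
    (hx : hS.extClass.comp x h = 0) : x = 0 := by
  obtain ⟨y, rfl⟩ := Ext.contravariant_sequence_exact₁ hS Y x h hx
  rw [Ext.eq_zero_of_projective y, Ext.comp_zero]

/-- A criterion for two classes of degree two to have a nonzero Yoneda product, in terms of
successive syzygies of `k`. -/
theorem exists_comp_ne_zero {P k Ω M L N M' L' Q R : C} [Projective P]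
    {f₀ : Ω ⟶ P} {g₀ : P ⟶ k} {w₀ : f₀ ≫ g₀ = 0} (h₀ : (ShortComplex.mk f₀ g₀ w₀).ShortExact)
    {f₁ : L ⟶ P} {g₁ : P ⟶ M} {w₁ : f₁ ≫ g₁ = 0} (h₁ : (ShortComplex.mk f₁ g₁ w₁).ShortExact)
    {f₂ : N ⟶ P} {g₂ : P ⟶ L} {w₂ : f₂ ≫ g₂ = 0} (h₂ : (ShortComplex.mk f₂ g₂ w₂).ShortExact)
    {f' : L' ⟶ P} {g' : P ⟶ M'} {w' : f' ≫ g' = 0} (h' : (ShortComplex.mk f' g' w').ShortExact)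
    {f₃ : R ⟶ P} {g₃ : P ⟶ Q} {w₃ : f₃ ≫ g₃ = 0} (h₃ : (ShortComplex.mk f₃ g₃ w₃).ShortExact)
    (π : Ω ⟶ M) (σ : M ⟶ Ω) (hσ : σ ≫ π = 𝟙 M) (π' : Ω ⟶ M')
    (φ : L ⟶ k) (φ' : L' ⟶ k) (ι : N ⟶ Ω) (hι : ι ≫ f₀ = f₂) (hφ : g₂ ≫ φ = g₀)
    (j : Q ⟶ N) (τ : P ⟶ P) (θ : R ⟶ L') (hθ : θ ≫ f' = f₃ ≫ τ)
    (hτ : τ ≫ g' = g₃ ≫ j ≫ ι ≫ π')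
    (hne : ∀ h : P ⟶ k, f₃ ≫ h ≠ θ ≫ φ') :
    ∃ β γ : Ext k k 2, β.comp γ (by norm_num : 2 + 2 = 4) ≠ 0 := by
  have hP₀ : Projective (ShortComplex.mk f₀ g₀ w₀).X₂ := ‹Projective P›
  have hP₁ : Projective (ShortComplex.mk f₁ g₁ w₁).X₂ := ‹Projective P›
  have hP₂ : Projective (ShortComplex.mk f₂ g₂ w₂).X₂ := ‹Projective P›
  let e₀ : Ext k Ω 1 := h₀.extClass
  let e₁ : Ext M L 1 := h₁.extClass
  let e₂ : Ext L N 1 := h₂.extClass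
  let e₃ : Ext Q R 1 := h₃.extClass
  let e' : Ext M' L' 1 := h'.extClass
  let δ : Ext Ω k 1 := (Ext.mk₀ π').comp (e'.comp (Ext.mk₀ φ') (add_zero 1)) (zero_add 1)
  let γ : Ext k k 2 := e₀.comp δ rfl
  refine ⟨e₀.comp ((Ext.mk₀ π).comp (e₁.comp (Ext.mk₀ φ) (add_zero 1)) (zero_add 1)) rfl, γ,
    fun H ↦ ?_⟩
  have H₀ : (Ext.mk₀ π).comp (e₁.comp ((Ext.mk₀ φ).comp γ (zero_add 2)) (rfl : 1 + 2 = 3))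
      (zero_add 3) = 0 := by
    refine eq_zero_of_extClass_comp_eq_zero h₀ (n := 2) _ (rfl : 1 + 3 = 4) ?_
    rw [← H, Ext.comp_assoc (a₂₃ := 3) _ _ _ _ rfl rfl, Ext.comp_assoc (a₂₃ := 3) _ _ _ _ rfl rfl,
      Ext.comp_assoc (a₂₃ := 2) _ _ _ _ rfl rfl]
  have H₁ : e₁.comp ((Ext.mk₀ φ).comp γ (zero_add 2)) (rfl : 1 + 2 = 3) = 0 := by
    rw [← Ext.mk₀_id_comp (e₁.comp _ _), ← hσ, ← Ext.mk₀_comp_mk₀,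
      Ext.comp_assoc (a₂₃ := 3) _ _ _ _ rfl rfl, H₀, Ext.comp_zero]
  have H₂ : (Ext.mk₀ φ).comp γ (zero_add 2) = 0 :=
    eq_zero_of_extClass_comp_eq_zero h₁ (n := 1) _ (rfl : 1 + 2 = 3) H₁
  have n₂ : e₂.comp (Ext.mk₀ ι) (add_zero 1) = (Ext.mk₀ φ).comp e₀ (zero_add 1) :=
    ShortComplex.ShortExact.extClass_naturality h₂ h₀
      { τ₁ := ι, τ₂ := 𝟙 P, τ₃ := φ, comm₁₂ := by simpa using hι, comm₂₃ := by simpa using hφ.symm }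
  have H₃ : (Ext.mk₀ ι).comp δ (zero_add 1) = 0 := by
    refine eq_zero_of_extClass_comp_eq_zero h₂ (n := 0) _ (rfl : 1 + 1 = 2) ?_
    rw [← H₂, ← Ext.comp_assoc (a₁₂ := 1) _ _ _ rfl rfl rfl]
    erw [n₂]
    rw [Ext.comp_assoc (a₂₃ := 2) _ _ _ _ rfl rfl]
  have n₃ : e₃.comp (Ext.mk₀ θ) (add_zero 1) =
      (Ext.mk₀ (j ≫ ι ≫ π')).comp e' (zero_add 1) :=
    ShortComplex.ShortExact.extClass_naturality h₃ h'
      { τ₁ := θ, τ₂ := τ, τ₃ := j ≫ ι ≫ π', comm₁₂ := hθ, comm₂₃ := hτ }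
  have H₄ : e₃.comp (Ext.mk₀ (θ ≫ φ')) (add_zero 1) = 0 := by
    rw [← Ext.mk₀_comp_mk₀, ← Ext.comp_assoc (a₁₂ := 1) _ _ _ rfl rfl rfl, n₃,
      ← Ext.mk₀_comp_mk₀, ← Ext.mk₀_comp_mk₀, Ext.comp_assoc (a₂₃ := 1) _ _ _ _ rfl rfl,
      Ext.comp_assoc (a₂₃ := 1) _ _ _ _ rfl rfl,
      Ext.comp_assoc (a₂₃ := 1) _ _ _ _ rfl rfl]
    erw [H₃]
    rw [Ext.comp_zero]
  obtain ⟨x, hx⟩ := Ext.contravariant_sequence_exact₁ h₃ k _ (rfl : 1 + 0 = 1) H₄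
  obtain ⟨h, rfl⟩ := Ext.addEquiv₀.symm.surjective x
  refine hne h (Ext.addEquiv₀.symm.injective ?_)
  simpa using hx

end Abelian

section Modules

variable {R : Type*} [Ring R]

lemma LinearMap.exists_comp_eq_of_ker_le {L M N : Type*} [AddCommGroup L] [Module R L]
    [AddCommGroup M] [Module R M] [AddCommGroup N] [Module R N] (f : L →ₗ[R] M) (h : L →ₗ[R] N)
    (hf : Function.Surjective f) (hk : LinearMap.ker f ≤ LinearMap.ker h) :
    ∃ φ : M →ₗ[R] N, φ ∘ₗ f = h := by
  refine ⟨(LinearMap.ker f).liftQ h hk ∘ₗ (f.quotKerEquivOfSurjective hf).symm.toLinearMap, ?_⟩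
  ext a
  have : (f.quotKerEquivOfSurjective hf).symm (f a) = Submodule.Quotient.mk a := by
    rw [LinearEquiv.symm_apply_eq]; rfl
  simp [this]

/-- Right multiplication by `c`, as a map onto the left ideal generated by `c`. -/
def mulRightSpan (c : R) : R →ₗ[R] Submodule.span R {c} :=
  (LinearMap.toSpanSingleton R R c).codRestrict _ fun a ↦
    Submodule.mem_span_singleton.2 ⟨a, rfl⟩

@[simp]
lemma coe_mulRightSpan (c a : R) : (mulRightSpan c a : R) = a * c := rfl

lemma mulRightSpan_surjective (c : R) : Function.Surjective (mulRightSpan c) := by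
  rintro ⟨b, hb⟩
  obtain ⟨a, rfl⟩ := Submodule.mem_span_singleton.1 hb
  exact ⟨a, rfl⟩

/-- The map `R ⧸ R c → M` sending the class of `1` to `x`, where `c • x = 0`. -/
def spanQuotLift {M : Type*} [AddCommGroup M] [Module R M] (c : R) (x : M) (h : c • x = 0) :
    (R ⧸ Submodule.span R {c}) →ₗ[R] M :=
  (Submodule.span R {c}).liftQ (LinearMap.toSpanSingleton R M x)
    ((Submodule.span_singleton_le_iff_mem _ _).2 h)

@[simp]
lemma spanQuotLift_mk {M : Type*} [AddCommGroup M] [Module R M] (c : R) (x : M) (h : c • x = 0)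
    (a : R) : spanQuotLift c x h (Submodule.Quotient.mk a) = a • x := rfl

end Modules

lemma shortExact_subtype {R : Type} [Ring R] {M N : Type} [AddCommGroup M] [Module R M]
    [AddCommGroup N] [Module R N] (L : Submodule R M) (h : M →ₗ[R] N)
    (hL : L = LinearMap.ker h) (hh : Function.Surjective h) :
    (ShortComplex.mk (ModuleCat.ofHom L.subtype) (ModuleCat.ofHom h) (by
      subst hL; ext x; exact x.2)).ShortExact := by
  subst hL
  exact ModuleCat.shortComplex_shortExact _ (LinearMap.exact_subtype_ker_map h)
    (Submodule.injective_subtype _) hh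

namespace A

variable {K}

/-- The class of a generator in `A`. -/
noncomputable def gen (i : Gen) : A K := RingQuot.mkAlgHom K (MonRel K) (g K i)

lemma induction_on {P : A K → Prop} (a : A K) (halg : ∀ c : K, P (algebraMap K (A K) c))
    (hgen : ∀ i, P (gen i)) (hmul : ∀ a b, P a → P b → P (a * b))
    (hadd : ∀ a b, P a → P b → P (a + b)) : P a := by
  obtain ⟨a, rfl⟩ := RingQuot.mkAlgHom_surjective K (MonRel K) a
  induction a using FreeAlgebra.induction with
  | grade0 c => simpa using halg c
  | grade1 i => exact hgen i
  | mul a b ha hb => simpa using hmul _ _ ha hb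
  | add a b ha hb => simpa using hadd _ _ ha hb

@[simp]
lemma aug_gen (i : Gen) : aug K (gen i) = 0 := by
  rw [aug, gen, RingQuot.liftAlgHom_mkAlgHom_apply]
  simp [g]

lemma mkAlgHom_eq_zero {a : FreeAlgebra K Gen} (h : MonRel K a 0) :
    RingQuot.mkAlgHom K (MonRel K) a = 0 := by
  rw [RingQuot.mkAlgHom_rel K h, map_zero]

lemma stu_eq_zero : (gen s * gen t * gen u : A K) = 0 := by
  simpa [gen] using mkAlgHom_eq_zero (MonRel.stu (K := K))

lemma nnpqr_eq_zero : (gen n * gen n * gen p * gen q * gen r : A K) = 0 := by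
  simpa [gen] using mkAlgHom_eq_zero (MonRel.nnpqr (K := K))

lemma pqrst_eq_zero : (gen p * gen q * gen r * gen s * gen t : A K) = 0 := by
  simpa [gen] using mkAlgHom_eq_zero (MonRel.pqrst (K := K))

lemma exists_algHom {B : Type*} [Ring B] [Algebra K B] (F : Gen → B)
    (hF : ∀ ⦃a b⦄, MonRel K a b → FreeAlgebra.lift K F a = FreeAlgebra.lift K F b) :
    ∃ ρ : A K →ₐ[K] B, ∀ i, ρ (gen i) = F i := by
  refine ⟨RingQuot.liftAlgHom K ⟨FreeAlgebra.lift K F, hF⟩, fun i ↦ ?_⟩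
  rw [gen, RingQuot.liftAlgHom_mkAlgHom_apply]
  simp [g]

/-- If `c` takes some vector of a representation to a nonzero vector killed by all generators, then
the left annihilator of `c` lies in the augmentation ideal. -/
lemma aug_eq_zero_of_mul_eq_zero {V : Type*} [AddCommGroup V] [Module K V]
    (ρ : A K →ₐ[K] Module.End K V) {x y : V} (hy : y ≠ 0) (hρ : ∀ i, ρ (gen i) y = 0)
    {c : A K} (hc : ρ c x = y) {a : A K} (h : a * c = 0) : aug K a = 0 := by
  have key : ρ a y = aug K a • y := by
    clear h
    induction a using induction_on with
    | halg c => simp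
    | hgen i => simp [hρ]
    | hmul a b ha hb => simp [ha, hb, smul_smul, mul_comm]
    | hadd a b ha hb => simp [ha, hb, add_smul]
  have : ρ a y = 0 := by rw [← hc, ← Module.End.mul_apply, ← map_mul, h]; simp
  exact (smul_eq_zero.1 (key.symm.trans this)).resolve_right hy

lemma aug_eq_zero_of_mul_st {a : A K} (h : a * (gen s * gen t) = 0) : aug K a = 0 := by
  obtain ⟨ρ, hρ⟩ := exists_algHom (K := K) (B := Module.End K (Fin 3 → K))
    (fun | t => LinearMap.single K (fun _ ↦ K) 1 ∘ₗ LinearMap.proj 0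
         | s => LinearMap.single K (fun _ ↦ K) 2 ∘ₗ LinearMap.proj 1
         | _ => 0) (by
      intro a b h
      cases h <;> simp [g])
  refine aug_eq_zero_of_mul_eq_zero ρ (x := Pi.single 0 1) (y := Pi.single 2 1)
    (by simp) (fun i ↦ ?_) ?_ h
  · rw [hρ]
    cases i <;> simp
  · simp [hρ]

lemma aug_eq_zero_of_mul_nnpq {a : A K} (h : a * (gen n * gen n * gen p * gen q) = 0) :
    aug K a = 0 := by
  obtain ⟨ρ, hρ⟩ := exists_algHom (K := K) (B := Module.End K (Fin 5 → K))
    (fun | q => LinearMap.single K (fun _ ↦ K) 1 ∘ₗ LinearMap.proj 0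
         | p => LinearMap.single K (fun _ ↦ K) 2 ∘ₗ LinearMap.proj 1
         | n => LinearMap.single K (fun _ ↦ K) 3 ∘ₗ LinearMap.proj 2 +
             LinearMap.single K (fun _ ↦ K) 4 ∘ₗ LinearMap.proj 3
         | _ => 0) (by
      intro a b h
      cases h <;> simp [g])
  refine aug_eq_zero_of_mul_eq_zero ρ (x := Pi.single 0 1) (y := Pi.single 4 1)
    (by simp) (fun i ↦ ?_) ?_ h
  · rw [hρ]
    cases i <;> simp
  · simp [hρ]

variable (K) in
/-- The augmentation, as a map of left `A`-modules. -/
noncomputable def augLin : A K →ₗ[A K] KMod K where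
  toFun := aug K
  map_add' := map_add _
  map_smul' a b := map_mul (aug K) a b

lemma augLin_eq_zero {a : A K} : augLin K a = 0 ↔ aug K a = 0 := Iff.rfl

lemma augLin_surjective : Function.Surjective (augLin K) :=
  fun c ↦ ⟨algebraMap K (A K) c, (aug K).commutes c⟩

lemma augLin_one_ne_zero : augLin K 1 ≠ 0 := by
  rw [Ne, augLin_eq_zero]; simp

/-- A map on the augmentation ideal may be prescribed on the generators, provided that the defining
monomials are respected. -/
lemma exists_ker_augLin_map {M : Type} [AddCommGroup M] [Module (A K) M] [Module K M]
    [IsScalarTower K (A K) M] (d : Gen → M)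
    (hp : (gen m * gen n * gen n : A K) • d p = 0)
    (hr : (gen n * gen n * gen p * gen q : A K) • d r = 0)
    (hs : (gen n * gen p * gen q * gen r : A K) • d s = 0)
    (ht : (gen p * gen q * gen r * gen s : A K) • d t = 0)
    (hu : (gen s * gen t : A K) • d u = 0)
    (hx : (gen t * gen u * gen v * gen w : A K) • d x = 0)
    (hy : (gen u * gen v * gen w * gen x : A K) • d y = 0)
    (hy' : (gen v * gen w * gen x * gen y : A K) • d y = 0)
    (hz : (gen x * gen y * gen y : A K) • d z = 0) :
    ∃ D : LinearMap.ker (augLin K) →ₗ[A K] M, ∀ (a : A K) (i : Gen)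
      (h : a * gen i ∈ LinearMap.ker (augLin K)), D ⟨a * gen i, h⟩ = a • d i := by
  let F : Gen → Module.End K (M × K) := fun i ↦ LinearMap.inl K M K ∘ₗ
    (Algebra.lsmul K K M (gen i : A K) ∘ₗ LinearMap.fst K M K +
      LinearMap.toSpanSingleton K M (d i) ∘ₗ LinearMap.snd K M K)
  have hF : ∀ i z, F i z = ((gen i : A K) • z.1 + z.2 • d i, 0) := fun i z ↦ rfl
  obtain ⟨ρ, hρ⟩ := exists_algHom (K := K) F (by
    have h0 {a : FreeAlgebra K Gen} (h : MonRel K a 0) (z : M) :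
      RingQuot.mkAlgHom K (MonRel K) a • z = 0 := by rw [mkAlgHom_eq_zero h, zero_smul]
    intro a b h
    have h1 := h0 (a := a) (by cases h <;> constructor)
    cases h <;> (
      simp only [map_mul] at h1
      ext z <;> simp [g, hF, smul_smul, ← mul_assoc] <;> first | assumption | exact h1 z))
  have h1 (a : A K) : ∀ z : M, ρ a (z, 0) = (a • z, 0) := by
    induction a using induction_on with
    | halg c => intro z; simp
    | hgen i => intro z; simp [hρ, hF]
    | hmul a b ha hb => simp [ha, hb, mul_smul]
    | hadd a b ha hb => simp [ha, hb, add_smul]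
  have h2 (a : A K) : ∀ z, (ρ a z).2 = aug K a * z.2 := by
    induction a using induction_on with
    | halg c => simp
    | hgen i => intro z; simp [hρ, hF]
    | hmul a b ha hb => simp [ha, hb, mul_assoc]
    | hadd a b ha hb => simp [ha, hb, add_mul]
  have h3 (a : A K) (ha : aug K a = 0) : ρ a (0, 1) = ((ρ a (0, 1)).1, 0) :=
    Prod.ext rfl (by simp [h2, ha])
  refine ⟨{ toFun a := (ρ a (0, 1)).1, map_add' := by simp, map_smul' := ?_ }, fun a i h ↦ ?_⟩
  · rintro b ⟨a, ha⟩
    change (ρ (b * a) (0, 1)).1 = _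
    rw [map_mul, Module.End.mul_apply, h3 a ha, h1]
    rfl
  · simp [hρ, hF, h1]

lemma smul_KMod_eq_zero {a : A K} (h : aug K a = 0) (c : KMod K) : a • c = 0 := by
  change aug K a * (show K from c) = 0
  rw [h, zero_mul]

end A

open A in
/-- There exist `β, γ ∈ Extᴬ²(K,K)` whose Yoneda product
`βγ ∈ Extᴬ⁴(K,K)` is nonzero. -/
theorem statement_12 :
    ∃ (β : E K 2) (γ : E K 2), β.comp γ (by norm_num : 2 + 2 = 4) ≠ 0 := by
  let st : A K := gen s * gen t
  let nnpq : A K := gen n * gen n * gen p * gen q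
  let nn : A K := gen n * gen n
  have hN : LinearMap.ker (mulRightSpan st) ≤ LinearMap.ker (augLin K) := fun a ha ↦
    aug_eq_zero_of_mul_st (K := K) (congrArg Subtype.val ha)
  obtain ⟨φ, hφ⟩ := (mulRightSpan st).exists_comp_eq_of_ker_le (augLin K)
    (mulRightSpan_surjective _) hN
  obtain ⟨φ', hφ'⟩ := (mulRightSpan nnpq).exists_comp_eq_of_ker_le (augLin K)
    (mulRightSpan_surjective _) fun a ha ↦
      aug_eq_zero_of_mul_nnpq (K := K) (congrArg Subtype.val ha)
  obtain ⟨π, hπ⟩ := exists_ker_augLin_map (K := K) (M := A K ⧸ Submodule.span (A K) {st})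
    (fun | u => Submodule.Quotient.mk 1 | _ => 0) (by simp) (by simp) (by simp) (by simp)
    (by
      rw [← Submodule.Quotient.mk_smul, Submodule.Quotient.mk_eq_zero, smul_eq_mul, mul_one]
      exact Submodule.mem_span_singleton_self _) (by simp) (by simp) (by simp) (by simp)
  obtain ⟨π', hπ'⟩ := exists_ker_augLin_map (K := K) (M := A K ⧸ Submodule.span (A K) {nnpq})
    (fun | r => Submodule.Quotient.mk 1 | _ => 0) (by simp)
    (by
      rw [← Submodule.Quotient.mk_smul, Submodule.Quotient.mk_eq_zero, smul_eq_mul, mul_one]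
      exact Submodule.mem_span_singleton_self _)
    (by simp) (by simp) (by simp) (by simp) (by simp) (by simp) (by simp)
  have hu : 1 * gen u ∈ LinearMap.ker (augLin K) := augLin_eq_zero.2 (by simp)
  let σ : (A K ⧸ Submodule.span (A K) {st}) →ₗ[A K] LinearMap.ker (augLin K) :=
    spanQuotLift st ⟨1 * gen u, hu⟩ (Subtype.ext (by
      simpa [st] using stu_eq_zero (K := K)))
  have hpqr : (gen p * gen q * gen r : A K) ∈ LinearMap.ker (mulRightSpan st) := by
    refine Subtype.ext ?_
    simpa [st, mul_assoc] using pqrst_eq_zero (K := K)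
  let j : (A K ⧸ Submodule.span (A K) {nn}) →ₗ[A K] LinearMap.ker (mulRightSpan st) :=
    spanQuotLift nn ⟨gen p * gen q * gen r, hpqr⟩ (Subtype.ext (by
      simpa [nn, mul_assoc] using nnpqr_eq_zero (K := K)))
  let τ : A K →ₗ[A K] A K := LinearMap.toSpanSingleton (A K) _ (gen p * gen q)
  have hτ : τ nn = nnpq := by simp [τ, nn, nnpq, mul_assoc]
  let θ : Submodule.span (A K) {nn} →ₗ[A K] Submodule.span (A K) {nnpq} :=
    τ.restrict (p := Submodule.span (A K) {nn}) (q := Submodule.span (A K) {nnpq}) (by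
      have : Submodule.span (A K) {nn} ≤ (Submodule.span (A K) {nnpq}).comap τ := by
        rw [Submodule.span_singleton_le_iff_mem, Submodule.mem_comap, hτ]
        exact Submodule.mem_span_singleton_self _
      exact this)
  refine exists_comp_ne_zero (P := ModuleCat.of (A K) (A K))
    (shortExact_subtype _ (augLin K) rfl augLin_surjective)
    (shortExact_subtype _ (Submodule.span (A K) {st}).mkQ (Submodule.ker_mkQ _).symm
      (Submodule.mkQ_surjective _))
    (shortExact_subtype _ (mulRightSpan st) rfl (mulRightSpan_surjective _))
    (shortExact_subtype _ (Submodule.span (A K) {nnpq}).mkQ (Submodule.ker_mkQ _).symm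
      (Submodule.mkQ_surjective _))
    (shortExact_subtype _ (Submodule.span (A K) {nn}).mkQ (Submodule.ker_mkQ _).symm
      (Submodule.mkQ_surjective _))
    (ModuleCat.ofHom π) (ModuleCat.ofHom σ) ?_ (ModuleCat.ofHom π') (ModuleCat.ofHom (Y := KMod K) φ)
    (ModuleCat.ofHom (Y := KMod K) φ') (ModuleCat.ofHom (Submodule.inclusion hN)) rfl ?_ (ModuleCat.ofHom j)
    (ModuleCat.ofHom τ) (ModuleCat.ofHom θ) rfl ?_ fun h H ↦ ?_
  · rw [← ModuleCat.ofHom_comp]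
    refine congrArg ModuleCat.ofHom (Submodule.linearMap_qext _ (LinearMap.ext_ring ?_))
    simpa [σ] using hπ 1 u hu
  · exact ModuleCat.hom_ext hφ
  · simp only [← ModuleCat.ofHom_comp]
    refine congrArg ModuleCat.ofHom (LinearMap.ext_ring ?_)
    have := hπ' (gen p * gen q) r (hN hpqr)
    rw [← Submodule.Quotient.mk_smul, smul_eq_mul, mul_one] at this
    simpa [τ, j, Submodule.inclusion_apply] using this.symm
  · have hnn : nn ∈ Submodule.span (A K) {nn} := Submodule.mem_span_singleton_self _
    have H' : h.hom nn = φ' (θ ⟨nn, hnn⟩) :=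
      LinearMap.congr_fun (congrArg ModuleCat.Hom.hom H) ⟨nn, hnn⟩
    have hθ : θ ⟨nn, hnn⟩ = mulRightSpan nnpq 1 := by
      refine Subtype.ext ?_
      rw [coe_mulRightSpan, one_mul]
      exact hτ
    rw [hθ, ← LinearMap.comp_apply, hφ'] at H'
    refine augLin_one_ne_zero (H'.symm.trans ?_)
    rw [← mul_one nn, ← smul_eq_mul, map_smul]
    exact smul_KMod_eq_zero (by simp [nn]) _
end

section
/- Let A be the monomial algebra on 13 generators defined below and K the trivial A-module. Then the total dimension of the Yoneda algebra of A is 39; that is, the sum over all n ≥ 0 of dim_K Extᴬⁿ(K,K) equals 1 + 13 + 9 + 8 + 4 + 3 + 1 = 39. -/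
/-!
Let `K` be a field and `V` a 13-dimensional `K`-vector space with basis
`{m,n,p,q,r,s,t,u,v,w,x,y,z}`.  Let `A = T(V)/I` be the quotient of the free
(tensor) algebra on `V` by the two-sided ideal generated by the nine monomials
`mn²p, n²pqr, npqrs, pqrst, stu, tuvwx, uvwxy, vwxy², xy²z`, and regard `K` as
the trivial left `A`-module via the augmentation sending every generator to `0`.
-/

open CategoryTheory

variable (K : Type) [Field K]

open Gen

/-- The `K`-vector space `Extᴬⁿ(K, K)`. -/
noncomputable def extKK (n : ℕ) : ModuleCat K :=
  ((Ext K (ModuleCat.{0} (A K)) n).obj (Opposite.op (KMod K))).obj (KMod K)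

/-- Every generator, in alphabetical order. -/
def letters : List Gen := [m, n, p, q, r, s, t, u, v, w, x, y, z]

theorem mem_letters (i : Gen) : i ∈ letters := by
  cases i <;> simp [letters]

/-- The position of a generator in the alphabetical order. -/
def Gen.code : Gen → ℕ
  | m => 0 | n => 1 | p => 2 | q => 3 | r => 4 | s => 5 | t => 6
  | u => 7 | v => 8 | w => 9 | x => 10 | y => 11 | z => 12

theorem Gen.code_injective : Function.Injective Gen.code := by
  intro a b
  cases a <;> cases b <;> simp [Gen.code]

instance : DecidableEq Gen := Gen.code_injective.decidableEq

/-- The nine defining monomials, as words. -/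
def rels : List (List Gen) :=
  [[m, n, n, p], [n, n, p, q, r], [n, p, q, r, s], [p, q, r, s, t], [s, t, u],
    [t, u, v, w, x], [u, v, w, x, y], [v, w, x, y, y], [x, y, y, z]]

/-- A word is normal if it contains none of the defining monomials. -/
def IsNormalWord (a : List Gen) : Prop := ∀ b ∈ rels, ¬ b <:+: a

instance (a : List Gen) : Decidable (IsNormalWord a) := by
  unfold IsNormalWord; infer_instance

theorem IsNormalWord.mono {a b : List Gen} (hb : IsNormalWord b) (h : a <:+: b) : IsNormalWord a :=
  fun c hc hca => hb c hc (hca.trans h)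

/-- The proper nonempty initial segments of defining monomials whose complement is an initial
segment of `b`. -/
def overlaps (b : List Gen) : List (List Gen) :=
  rels.flatMap fun c =>
    ((List.range c.length).filter fun i => 0 < i ∧ c.drop i <+: b).map fun i => c.take i

theorem mem_overlaps {a b : List Gen} :
    a ∈ overlaps b ↔ a ≠ [] ∧ ∃ c, c ≠ [] ∧ a ++ c ∈ rels ∧ c <+: b := by
  simp only [overlaps, List.mem_flatMap, List.mem_map, List.mem_filter, List.mem_range,
    decide_eq_true_eq]
  constructor
  · rintro ⟨c, hc, i, ⟨hi, hi0, hib⟩, rfl⟩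
    refine ⟨?_, c.drop i, ?_, by simpa using hc, hib⟩
    · simp only [ne_eq, List.take_eq_nil_iff, not_or]
      exact ⟨hi0.ne', by rintro rfl; simp at hi⟩
    · simpa using hi
  · rintro ⟨ha, c, hc, hac, hcb⟩
    refine ⟨a ++ c, hac, a.length, ⟨?_, ?_, ?_⟩, by simp⟩
    · simpa using List.length_pos_iff.2 hc
    · exact List.length_pos_iff.2 ha
    · simpa using hcb

/-- The suffix-minimal generators of the left annihilator of a nonempty normal word `b` in `A`;
for the empty word, the generators of the augmentation ideal. -/
def syzygies (b : List Gen) : List (List Gen) :=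
  if b = [] then letters.map fun i => [i]
  else (overlaps b).filter fun a => ∀ c ∈ overlaps b, c <:+ a → c = a

theorem syzygies_nil : syzygies [] = letters.map fun i => [i] := rfl

theorem mem_syzygies {a b : List Gen} (hb : b ≠ []) :
    a ∈ syzygies b ↔ a ∈ overlaps b ∧ ∀ c ∈ overlaps b, c <:+ a → c = a := by
  simp [syzygies, hb]

theorem eq_of_suffix_of_mem_syzygies {a b c : List Gen} (ha : a ∈ syzygies c)
    (hb : b ∈ syzygies c) (h : a <:+ b) : a = b := by
  by_cases hc : c = []
  · subst hc
    simp only [syzygies_nil, List.mem_map] at ha hb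
    obtain ⟨i, -, rfl⟩ := ha
    obtain ⟨j, -, rfl⟩ := hb
    exact h.eq_of_length rfl
  · rw [mem_syzygies hc] at ha hb
    exact hb.2 a ha.1 h

theorem ne_nil_of_mem_syzygies {a b : List Gen} (ha : a ∈ syzygies b) : a ≠ [] := by
  by_cases hb : b = []
  · subst hb
    simp only [syzygies_nil, List.mem_map] at ha
    obtain ⟨i, -, rfl⟩ := ha
    simp
  · exact (mem_overlaps.1 ((mem_syzygies hb).1 ha).1).1

theorem normal_take_of_mem_rels :
    ∀ c ∈ rels, ∀ i < c.length, IsNormalWord (c.take i) := by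
  decide +kernel

theorem normal_singleton (i : Gen) : IsNormalWord [i] := by
  cases i <;> decide +kernel

theorem normal_of_mem_syzygies {a b : List Gen} (ha : a ∈ syzygies b) : IsNormalWord a := by
  by_cases hb : b = []
  · subst hb
    simp only [syzygies_nil, List.mem_map] at ha
    obtain ⟨i, -, rfl⟩ := ha
    exact normal_singleton i
  · obtain ⟨-, c, hc, hac, -⟩ := mem_overlaps.1 ((mem_syzygies hb).1 ha).1
    simpa using normal_take_of_mem_rels _ hac a.length
      (by simpa using List.length_pos_iff.2 hc)

theorem not_normal_append_of_mem_syzygies {a b : List Gen} (hb : b ≠ [])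
    (ha : a ∈ syzygies b) : ¬ IsNormalWord (a ++ b) := by
  obtain ⟨-, c, -, hac, d, rfl⟩ := mem_overlaps.1 ((mem_syzygies hb).1 ha).1
  exact fun h => h _ hac ⟨[], d, by simp⟩

theorem exists_mem_syzygies_suffix_of_mem_overlaps {b : List Gen} (hb : b ≠ [])
    {a : List Gen} (ha : a ∈ overlaps b) : ∃ c ∈ syzygies b, c <:+ a := by
  induction h : a.length using Nat.strong_induction_on generalizing a with
  | _ k ih =>
    by_cases hmin : ∀ c ∈ overlaps b, c <:+ a → c = a
    · exact ⟨a, (mem_syzygies hb).2 ⟨ha, hmin⟩, List.suffix_rfl⟩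
    · push Not at hmin
      obtain ⟨c, hc, hca, hne⟩ := hmin
      have hlt : c.length < k :=
        h ▸ lt_of_le_of_ne hca.length_le fun hl => hne (hca.eq_of_length hl)
      obtain ⟨d, hd, hdc⟩ := ih _ hlt hc rfl
      exact ⟨d, hd, hdc.trans hca⟩

theorem cases_of_isInfix_append {a b e : List Gen} (h : e <:+: a ++ b) :
    e <:+: a ∨ e <:+: b ∨ ∃ c d, e = c ++ d ∧ c <:+ a ∧ d <+: b := by
  obtain ⟨c, d, h⟩ := h
  rw [List.append_assoc, List.append_eq_append_iff] at h
  obtain ⟨f, rfl, h⟩ | ⟨f, rfl, rfl⟩ := h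
  · rw [List.append_eq_append_iff] at h
    obtain ⟨g, rfl, rfl⟩ | ⟨g, rfl, rfl⟩ := h
    · exact .inl ⟨c, g, by simp⟩
    · exact .inr (.inr ⟨f, g, rfl, ⟨c, rfl⟩, ⟨d, rfl⟩⟩)
  · exact .inr (.inl ⟨f, d, by simp⟩)

theorem exists_mem_syzygies_suffix {a b : List Gen} (hb : b ≠ []) (hna : IsNormalWord a)
    (hnb : IsNormalWord b) (hab : ¬ IsNormalWord (a ++ b)) : ∃ c ∈ syzygies b, c <:+ a := by
  simp only [IsNormalWord, not_forall, not_not] at hab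
  obtain ⟨e, he, hinf⟩ := hab
  obtain h | h | ⟨c, d, rfl, hc, hd⟩ := cases_of_isInfix_append hinf
  · exact absurd h (hna e he)
  · exact absurd h (hnb e he)
  · have hc0 : c ≠ [] := by
      rintro rfl
      exact hnb d (by simpa using he) hd.isInfix
    have hd0 : d ≠ [] := by
      rintro rfl
      exact hna c (by simpa using he) hc.isInfix
    obtain ⟨f, hf, hfc⟩ :=
      exists_mem_syzygies_suffix_of_mem_overlaps hb (mem_overlaps.2 ⟨hc0, d, hd0, he, hd⟩)
    exact ⟨f, hf, hfc.trans hc⟩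

/-- The chains indexing the `k`-th term of the minimal resolution of the trivial module: lists of
words in which each word is a minimal syzygy of the one after it. -/
def chains : ℕ → List (List (List Gen))
  | 0 => [[]]
  | k + 1 => (chains k).flatMap fun c => (syzygies (c.headD [])).map fun a => a :: c

theorem mem_chains_succ {k : ℕ} {c : List (List Gen)} :
    c ∈ chains (k + 1) ↔ ∃ b ∈ chains k, ∃ a ∈ syzygies (b.headD []), a :: b = c := by
  simp [chains]

theorem cons_mem_chains {k : ℕ} {a : List Gen} {b : List (List Gen)} :
    a :: b ∈ chains (k + 1) ↔ b ∈ chains k ∧ a ∈ syzygies (b.headD []) := by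
  simp [mem_chains_succ]

theorem normal_headD {k : ℕ} {c : List (List Gen)} (hc : c ∈ chains k) :
    IsNormalWord (c.headD []) := by
  cases k with
  | zero =>
    obtain rfl : c = [] := by simpa [chains] using hc
    decide +kernel
  | succ k =>
    obtain ⟨b, -, a, ha, rfl⟩ := mem_chains_succ.1 hc
    exact normal_of_mem_syzygies ha

theorem chains_add_seven (k : ℕ) : chains (k + 7) = [] := by
  induction k with
  | zero => decide +kernel
  | succ k ih => rw [show k + 1 + 7 = k + 7 + 1 by ring, chains, ih]; rfl

theorem sum_card_chains :
    ∑ k ∈ Finset.range 7, (chains k).toFinset.card = 39 := by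
  decide +kernel

/-- The class in `A` of the word `a`. -/
noncomputable def mon (a : List Gen) : A K :=
  RingQuot.mkAlgHom K (MonRel K) (a.map (g K)).prod

theorem mon_nil : mon K [] = 1 := by simp [mon]

theorem mon_append (a b : List Gen) : mon K (a ++ b) = mon K a * mon K b := by
  simp [mon]

theorem MonRel.exists_mem_rels {e f : FreeAlgebra K Gen} (h : MonRel K e f) :
    ∃ a ∈ rels, e = (a.map (g K)).prod ∧ f = 0 := by
  cases h with
  | mnnp => exact ⟨[m, n, n, p], by simp [rels], by simp [mul_assoc], rfl⟩
  | nnpqr => exact ⟨[n, n, p, q, r], by simp [rels], by simp [mul_assoc], rfl⟩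
  | npqrs => exact ⟨[n, p, q, r, s], by simp [rels], by simp [mul_assoc], rfl⟩
  | pqrst => exact ⟨[p, q, r, s, t], by simp [rels], by simp [mul_assoc], rfl⟩
  | stu => exact ⟨[s, t, u], by simp [rels], by simp [mul_assoc], rfl⟩
  | tuvwx => exact ⟨[t, u, v, w, x], by simp [rels], by simp [mul_assoc], rfl⟩
  | uvwxy => exact ⟨[u, v, w, x, y], by simp [rels], by simp [mul_assoc], rfl⟩
  | vwxyy => exact ⟨[v, w, x, y, y], by simp [rels], by simp [mul_assoc], rfl⟩
  | xyyz => exact ⟨[x, y, y, z], by simp [rels], by simp [mul_assoc], rfl⟩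

theorem mon_eq_zero_of_mem_rels : ∀ b ∈ rels, mon K b = 0 := by
  have key : ∀ e : FreeAlgebra K Gen, MonRel K e 0 → RingQuot.mkAlgHom K (MonRel K) e = 0 :=
    fun e he =>
      (RingQuot.mkAlgHom_rel K he).trans (map_zero (RingQuot.mkAlgHom K (MonRel K)))
  simp only [rels, List.forall_mem_cons, mon, List.map_cons, List.map_nil, List.prod_cons,
    List.prod_nil, mul_one, ← mul_assoc]
  exact ⟨key _ .mnnp, key _ .nnpqr, key _ .npqrs, key _ .pqrst, key _ .stu, key _ .tuvwx,
    key _ .uvwxy, key _ .vwxyy, key _ .xyyz, by simp⟩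

theorem mon_eq_zero_of_not_isNormalWord {a : List Gen} (h : ¬ IsNormalWord a) : mon K a = 0 := by
  simp only [IsNormalWord, not_forall, not_not] at h
  obtain ⟨b, hb, c, d, rfl⟩ := h
  simp [mon_append, mon_eq_zero_of_mem_rels K b hb]

theorem span_range_mon : Submodule.span K (Set.range (mon K)) = ⊤ := by
  rw [eq_top_iff]
  rintro e -
  obtain ⟨e, rfl⟩ := RingQuot.mkAlgHom_surjective K (MonRel K) e
  induction e using FreeAlgebra.induction with
  | grade0 c =>
    rw [AlgHom.commutes, Algebra.algebraMap_eq_smul_one]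
    exact Submodule.smul_mem _ _ (Submodule.subset_span ⟨[], mon_nil K⟩)
  | grade1 i => exact Submodule.subset_span ⟨[i], by simp [mon, g]⟩
  | add e f he hf => rw [map_add]; exact add_mem he hf
  | mul e f he hf =>
    rw [map_mul]
    have hef := Submodule.mul_mem_mul he hf
    rw [Submodule.span_mul_span] at hef
    refine Submodule.span_le.2 ?_ hef
    rintro _ ⟨_, ⟨a, rfl⟩, _, ⟨b, rfl⟩, rfl⟩
    exact Submodule.subset_span ⟨a ++ b, mon_append K a b⟩

variable {K} in
/-- Linear maps out of `A` agreeing on words are equal. -/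
theorem linearMap_ext_mon {M : Type*} [AddCommMonoid M] [Module K M] {φ ψ : A K →ₗ[K] M}
    (h : ∀ a, φ (mon K a) = ψ (mon K a)) : φ = ψ :=
  LinearMap.ext_on_range (span_range_mon K) h

/-- Left multiplication by a generator, on combinations of normal words. -/
noncomputable def leftMul (i : Gen) : Module.End K (List Gen →₀ K) :=
  Finsupp.linearCombination K fun a =>
    if IsNormalWord (i :: a) then Finsupp.single (i :: a) 1 else 0

theorem prod_leftMul_single (a b : List Gen) :
    (a.map (leftMul K)).prod (Finsupp.single b 1) =
      if a = [] ∨ IsNormalWord (a ++ b) then Finsupp.single (a ++ b) 1 else 0 := by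
  induction a with
  | nil => simp
  | cons i a ih =>
    rw [List.map_cons, List.prod_cons, Module.End.mul_apply, ih]
    by_cases h : a = [] ∨ IsNormalWord (a ++ b)
    · simp [h, leftMul]
    · have : ¬ IsNormalWord (i :: a ++ b) := fun h' =>
        h (.inr (h'.mono ⟨[i], [], by simp⟩))
      simp_all

theorem prod_leftMul_eq_zero_of_mem_rels {a : List Gen} (ha : a ∈ rels) :
    (a.map (leftMul K)).prod = 0 := by
  refine Finsupp.lhom_ext' fun b => LinearMap.ext_ring ?_
  have h1 : a ≠ [] := by
    rintro rfl
    simp [rels] at ha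
  have h2 : ¬ IsNormalWord (a ++ b) := fun h => h a ha ⟨[], b, by simp⟩
  simpa [h1, h2] using prod_leftMul_single K a b

/-- The action of `A` on combinations of normal words. -/
noncomputable def wordRep : A K →ₐ[K] Module.End K (List Gen →₀ K) :=
  RingQuot.liftAlgHom K ⟨FreeAlgebra.lift K (leftMul K), by
    intro e f h
    obtain ⟨a, ha, rfl, rfl⟩ := MonRel.exists_mem_rels K h
    rw [map_zero, ← prod_leftMul_eq_zero_of_mem_rels K ha, map_list_prod, List.map_map]
    congr 2
    funext i
    simp [g]⟩

theorem wordRep_mon (a : List Gen) : wordRep K (mon K a) = (a.map (leftMul K)).prod := by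
  rw [wordRep, mon, RingQuot.liftAlgHom_mkAlgHom_apply, map_list_prod, List.map_map]
  congr 2
  funext i
  simp [g]

/-- The coordinates of an element of `A` with respect to the words. -/
noncomputable def coords : A K →ₗ[K] (List Gen →₀ K) :=
  LinearMap.applyₗ (Finsupp.single [] 1) ∘ₗ (wordRep K).toLinearMap

theorem coords_mon (a : List Gen) :
    coords K (mon K a) = if IsNormalWord a then Finsupp.single a 1 else 0 := by
  have : IsNormalWord [] := by decide +kernel
  simp only [coords, LinearMap.comp_apply, AlgHom.toLinearMap_apply, LinearMap.applyₗ_apply_apply,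
    wordRep_mon, prod_leftMul_single, List.append_nil]
  by_cases h : a = []
  · subst h
    simp [this]
  · simp [h]

theorem sum_coords (e : A K) : (coords K e).sum (fun a c => c • mon K a) = e := by
  have : Finsupp.linearCombination K (mon K) ∘ₗ coords K = LinearMap.id := by
    refine linearMap_ext_mon fun a => ?_
    by_cases h : IsNormalWord a
    · simp [coords_mon, h]
    · simp [mon_eq_zero_of_not_isNormalWord K h]
  simpa [Finsupp.linearCombination_apply] using LinearMap.congr_fun this e

theorem isNormalWord_of_coords_ne_zero {e : A K} {a : List Gen} (h : coords K e a ≠ 0) :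
    IsNormalWord a := by
  contrapose! h
  have : Finsupp.lapply a ∘ₗ coords K = (0 : A K →ₗ[K] K) := by
    refine linearMap_ext_mon fun b => ?_
    by_cases hb : IsNormalWord b
    · have : b ≠ a := fun hab => h (hab ▸ hb)
      simp [coords_mon, hb, this]
    · simp [coords_mon, hb]
  simpa using LinearMap.congr_fun this e

theorem coords_mul_mon_append (e : A K) {a b : List Gen} (h : IsNormalWord (a ++ b)) :
    coords K (e * mon K b) (a ++ b) = coords K e a := by
  have : Finsupp.lapply (a ++ b) ∘ₗ coords K ∘ₗ LinearMap.mulRight K (mon K b) =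
      Finsupp.lapply a ∘ₗ coords K := by
    refine linearMap_ext_mon fun c => ?_
    simp only [LinearMap.comp_apply, LinearMap.mulRight_apply, ← mon_append, coords_mon]
    by_cases hc : c = a
    · subst hc
      have : IsNormalWord c := h.mono ⟨[], b, by simp⟩
      simp [h, this]
    · split_ifs <;> simp [hc]
  simpa using LinearMap.congr_fun this e

theorem coords_mul_mon_of_not_suffix (e : A K) {a b : List Gen} (h : ¬ b <:+ a) :
    coords K (e * mon K b) a = 0 := by
  have : Finsupp.lapply a ∘ₗ coords K ∘ₗ LinearMap.mulRight K (mon K b) = 0 := by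
    refine linearMap_ext_mon fun c => ?_
    simp only [LinearMap.comp_apply, LinearMap.mulRight_apply, ← mon_append, coords_mon]
    have : c ++ b ≠ a := fun hc => h ⟨c, hc⟩
    split_ifs <;> simp [this]
  simpa using LinearMap.congr_fun this e

theorem aug_mon (a : List Gen) : aug K (mon K a) = if a = [] then 1 else 0 := by
  rw [aug, mon, RingQuot.liftAlgHom_mkAlgHom_apply]
  cases a <;> simp [g]

theorem aug_eq_coords_nil (e : A K) : aug K e = coords K e [] := by
  have : (aug K).toLinearMap = Finsupp.lapply [] ∘ₗ coords K := by
    refine linearMap_ext_mon fun a => ?_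
    have : IsNormalWord [] := by decide +kernel
    by_cases h : a = []
    · subst h
      simp [coords_mon, this, aug_mon]
    · rw [AlgHom.toLinearMap_apply, aug_mon, if_neg h, LinearMap.comp_apply, coords_mon]
      split_ifs <;> simp [h]
  simpa using LinearMap.congr_fun this e

/-- The index set of the basis of the `k`-th term of the minimal resolution. -/
abbrev Chain (k : ℕ) : Type := {c : List (List Gen) // c ∈ chains k}

namespace Chain

/-- The first word of a chain, or the empty word for the empty chain. -/
def head {k : ℕ} (c : Chain k) : List Gen := c.1.headD []

/-- Remove the first word of a chain. -/
def tail {k : ℕ} (c : Chain (k + 1)) : Chain k :=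
  ⟨c.1.tail, by
    obtain ⟨b, hb, a, -, h⟩ := mem_chains_succ.1 c.2
    simpa [← h] using hb⟩

/-- Extend a chain by a syzygy of its first word. -/
def cons {k : ℕ} (c : Chain k) (a : List Gen) (ha : a ∈ syzygies c.head) : Chain (k + 1) :=
  ⟨a :: c.1, cons_mem_chains.2 ⟨c.2, ha⟩⟩

@[simp]
theorem head_cons {k : ℕ} (c : Chain k) (a : List Gen) (ha : a ∈ syzygies c.head) :
    (c.cons a ha).head = a := rfl

@[simp]
theorem tail_cons {k : ℕ} (c : Chain k) (a : List Gen) (ha : a ∈ syzygies c.head) :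
    (c.cons a ha).tail = c := rfl

theorem head_mem_syzygies {k : ℕ} (c : Chain (k + 1)) : c.head ∈ syzygies c.tail.head := by
  obtain ⟨c, hc⟩ := c
  obtain ⟨b, hb, a, ha, rfl⟩ := mem_chains_succ.1 hc
  exact ha

theorem head_ne_nil {k : ℕ} (c : Chain (k + 1)) : c.head ≠ [] :=
  ne_nil_of_mem_syzygies c.head_mem_syzygies

theorem isNormalWord_head {k : ℕ} (c : Chain k) : IsNormalWord c.head :=
  normal_headD c.2

theorem ext_head_tail {k : ℕ} {b c : Chain (k + 1)} (hh : b.head = c.head)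
    (ht : b.tail = c.tail) : b = c := by
  obtain ⟨b, hb⟩ := b
  obtain ⟨c, hc⟩ := c
  obtain ⟨b, -, a, -, rfl⟩ := mem_chains_succ.1 hb
  obtain ⟨c, -, d, -, rfl⟩ := mem_chains_succ.1 hc
  simp_all [head, tail]

theorem head_zero (c : Chain 0) : c.head = [] := by
  obtain ⟨c, hc⟩ := c
  obtain rfl : c = [] := by simpa [chains] using hc
  rfl

end Chain

/-- The differential of the minimal resolution: it sends the basis vector of a chain to the class
of its first word times the basis vector of the remaining chain. -/
noncomputable def bdry (k : ℕ) : (Chain (k + 1) →₀ A K) →ₗ[A K] (Chain k →₀ A K) :=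
  Finsupp.linearCombination (A K) fun c => Finsupp.single c.tail (mon K c.head)

theorem bdry_single {k : ℕ} (c : Chain (k + 1)) (e : A K) :
    bdry K k (Finsupp.single c e) = Finsupp.single c.tail (e * mon K c.head) := by
  simp [bdry]

theorem bdry_comp_bdry (k : ℕ) : bdry K k ∘ₗ bdry K (k + 1) = 0 := by
  refine Finsupp.lhom_ext fun c e => ?_
  rw [LinearMap.comp_apply, bdry_single, bdry_single, mul_assoc, ← mon_append,
    mon_eq_zero_of_not_isNormalWord K
      (not_normal_append_of_mem_syzygies c.tail.head_ne_nil c.head_mem_syzygies)]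
  simp

theorem single_mem_range_bdry {k : ℕ} (c : Chain k) {e : A K}
    (h : ∀ a, coords K e a ≠ 0 → ∃ b ∈ syzygies c.head, b <:+ a) :
    Finsupp.single c e ∈ LinearMap.range (bdry K k) := by
  rw [← sum_coords K e, Finsupp.sum, Finsupp.single_finsetSum]
  refine Submodule.sum_mem _ fun a ha => ?_
  obtain ⟨b, hb, d, rfl⟩ := h a (Finsupp.mem_support_iff.1 ha)
  refine ⟨Finsupp.single (c.cons b hb) (coords K e (d ++ b) • mon K d), ?_⟩
  simp [bdry_single, mon_append]

theorem coords_apply_eq_zero_of_bdry_eq_zero {k : ℕ} {f : Chain (k + 1) →₀ A K}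
    (hf : bdry K k f = 0) (c : Chain (k + 1)) {a : List Gen} (ha : IsNormalWord (a ++ c.head)) :
    coords K (f c) a = 0 := by
  rw [← coords_mul_mon_append K (f c) ha]
  have h := congr_arg (fun e => coords K (e c.tail) (a ++ c.head)) hf
  simp only [bdry, Finsupp.linearCombination_apply, Finsupp.sum, Finsupp.coe_finsetSum,
    Finset.sum_apply, map_sum, Finsupp.coe_zero, Pi.zero_apply, map_zero] at h
  rw [Finset.sum_eq_single c] at h
  · simpa using h
  · intro b _ hbc
    by_cases ht : b.tail = c.tail
    · rw [ht, Finsupp.smul_single, Finsupp.single_eq_same, smul_eq_mul]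
      refine coords_mul_mon_of_not_suffix K _ fun hs => hbc (Chain.ext_head_tail ?_ ht)
      have hb := b.head_mem_syzygies
      rw [ht] at hb
      obtain h' | h' := List.suffix_or_suffix_of_suffix hs (List.suffix_append a c.head)
      · exact eq_of_suffix_of_mem_syzygies hb c.head_mem_syzygies h'
      · exact (eq_of_suffix_of_mem_syzygies c.head_mem_syzygies hb h').symm
    · simp [Finsupp.single_eq_of_ne' ht]
  · intro hc
    simp [Finsupp.notMem_support_iff.1 hc]

theorem range_bdry_succ (k : ℕ) :
    LinearMap.range (bdry K (k + 1)) = LinearMap.ker (bdry K k) := by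
  refine le_antisymm (LinearMap.range_le_ker_iff.2 (bdry_comp_bdry K k)) fun f hf => ?_
  rw [← Finsupp.sum_single f]
  refine Submodule.sum_mem _ fun c _ => single_mem_range_bdry K c fun a ha => ?_
  refine exists_mem_syzygies_suffix c.head_ne_nil (isNormalWord_of_coords_ne_zero K ha)
    c.isNormalWord_head fun hn => ha ?_
  exact coords_apply_eq_zero_of_bdry_eq_zero K hf c hn

/-- The identification of the field with the trivial module. -/
noncomputable def toKMod : K ≃+ KMod K := AddEquiv.refl K

theorem smul_toKMod (e : A K) (c : K) : e • toKMod K c = toKMod K (aug K e * c) := rfl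

theorem smul_eq_zero_of_aug_eq_zero {e : A K} (he : aug K e = 0) (c : KMod K) : e • c = 0 := by
  obtain ⟨c, rfl⟩ := (toKMod K).surjective c
  rw [smul_toKMod, he, zero_mul, map_zero]

/-- The augmentation of the minimal resolution. -/
noncomputable def bdryAug : (Chain 0 →₀ A K) →ₗ[A K] KMod K :=
  Finsupp.linearCombination (A K) fun _ => toKMod K 1

theorem bdryAug_single (c : Chain 0) (e : A K) :
    bdryAug K (Finsupp.single c e) = toKMod K (aug K e) := by
  simp [bdryAug, smul_toKMod]

theorem bdryAug_surjective : Function.Surjective (bdryAug K) := fun c => by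
  obtain ⟨c, rfl⟩ := (toKMod K).surjective c
  refine ⟨Finsupp.single ⟨[], by simp [chains]⟩ (algebraMap K (A K) c), ?_⟩
  rw [bdryAug_single, AlgHom.commutes]
  rfl

theorem range_bdry_zero : LinearMap.range (bdry K 0) = LinearMap.ker (bdryAug K) := by
  refine le_antisymm (LinearMap.range_le_ker_iff.2 ?_) fun f hf => ?_
  · refine Finsupp.lhom_ext fun c e => ?_
    rw [LinearMap.comp_apply, bdry_single, bdryAug_single, map_mul, aug_mon,
      if_neg c.head_ne_nil, mul_zero, map_zero, LinearMap.zero_apply]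
  · obtain ⟨e, rfl⟩ : ∃ e, f = Finsupp.single (⟨[], by simp [chains]⟩ : Chain 0) e := by
      refine ⟨f ⟨[], by simp [chains]⟩, ?_⟩
      ext c
      obtain ⟨c, hc⟩ := c
      obtain rfl : c = [] := by simpa [chains] using hc
      simp
    have he : coords K e [] = 0 := by
      rwa [LinearMap.mem_ker, bdryAug_single, aug_eq_coords_nil, map_eq_zero_iff _
        (toKMod K).injective] at hf
    refine single_mem_range_bdry K _ fun a ha => ?_
    have ha0 : a ≠ [] := by
      rintro rfl
      exact ha he
    rw [Chain.head_zero, syzygies_nil]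
    exact ⟨[a.getLast ha0], by simp [mem_letters],
      a.dropLast, List.dropLast_append_getLast ha0⟩

theorem linearMap_comp_bdry {k : ℕ} (φ : (Chain k →₀ A K) →ₗ[A K] KMod K) :
    φ ∘ₗ bdry K k = 0 := by
  refine Finsupp.lhom_ext fun c e => ?_
  rw [LinearMap.comp_apply, bdry_single, ← mul_one (e * _), ← smul_eq_mul,
    ← Finsupp.smul_single, map_smul]
  refine smul_eq_zero_of_aug_eq_zero K ?_ _
  rw [map_mul, aug_mon, if_neg c.head_ne_nil, mul_zero]

/-- The underlying complex of the minimal resolution of the trivial module. -/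
noncomputable def resComplex : ChainComplex (ModuleCat.{0} (A K)) ℕ :=
  ChainComplex.of (fun k => ModuleCat.of (A K) (Chain k →₀ A K))
    (fun k => ModuleCat.ofHom (bdry K k))
    (fun k => by rw [← ModuleCat.ofHom_comp, bdry_comp_bdry]; rfl)

theorem resComplex_d (k : ℕ) : (resComplex K).d (k + 1) k = ModuleCat.ofHom (bdry K k) :=
  ChainComplex.of_d (fun k => ModuleCat.of (A K) (Chain k →₀ A K))
    (fun k => ModuleCat.ofHom (bdry K k)) k

theorem resComplex_exactAt_succ (k : ℕ) : (resComplex K).ExactAt (k + 1) := by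
  rw [HomologicalComplex.exactAt_iff' _ (k + 2) (k + 1) k (by simp) (by simp),
    ShortComplex.moduleCat_exact_iff_range_eq_ker]
  change LinearMap.range ((resComplex K).d (k + 2) (k + 1)).hom =
    LinearMap.ker ((resComplex K).d (k + 1) k).hom
  rw [resComplex_d, resComplex_d]
  exact range_bdry_succ K k

/-- The augmentation of the minimal resolution, as a map of complexes. -/
noncomputable def resAug : resComplex K ⟶ (ChainComplex.single₀ _).obj (KMod K) :=
  ((resComplex K).toSingle₀Equiv _).symm ⟨ModuleCat.ofHom (Y := KMod K) (bdryAug K), by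
    rw [resComplex_d]
    exact ModuleCat.hom_ext (LinearMap.range_le_ker_iff.1 (range_bdry_zero K).le)⟩

theorem quasiIso_resAug : QuasiIso (resAug K) where
  quasiIsoAt k := by
    cases k with
    | zero =>
      rw [ChainComplex.quasiIsoAt₀_iff, ShortComplex.quasiIso_iff_of_zeros' _ rfl rfl rfl]
      constructor
      · rw [ShortComplex.moduleCat_exact_iff_range_eq_ker]
        change LinearMap.range ((resComplex K).d 1 0).hom = LinearMap.ker (bdryAug K)
        rw [resComplex_d]
        exact range_bdry_zero K
      · exact (ModuleCat.epi_iff_surjective _).2 (bdryAug_surjective K)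
    | succ k =>
      rw [quasiIsoAt_iff_exactAt' (hL := ChainComplex.exactAt_succ_single_obj ..)]
      exact resComplex_exactAt_succ K k

/-- The minimal projective resolution of the trivial module. -/
noncomputable def resolution : ProjectiveResolution (KMod K) where
  complex := resComplex K
  projective k := ModuleCat.projective_of_free
    (Finsupp.basisSingleOne : Module.Basis (Chain k) (A K) (Chain k →₀ A K))
  π := resAug K
  quasiIso := quasiIso_resAug K

/-- Maps out of a term of the minimal resolution to the trivial module are functions on chains. -/
noncomputable def homEquiv (k : ℕ) :
    (ModuleCat.of (A K) (Chain k →₀ A K) ⟶ KMod K) ≃ₗ[K] (Chain k → K) where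
  toFun φ c := (toKMod K).symm (φ.hom (Finsupp.single c 1))
  invFun a := ModuleCat.ofHom (Y := KMod K) (Finsupp.linearCombination (A K) fun c => toKMod K (a c))
  map_add' φ ψ := by ext c; simp
  map_smul' b φ := by
    ext c
    obtain ⟨d, hd⟩ := (toKMod K).surjective (φ.hom (Finsupp.single c 1))
    change (toKMod K).symm (algebraMap K (A K) b • φ.hom (Finsupp.single c 1)) = _
    rw [← hd, smul_toKMod, AlgHom.commutes]
    simp [← hd]
  left_inv φ := by
    refine ModuleCat.hom_ext (Finsupp.lhom_ext' fun c => LinearMap.ext_ring ?_)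
    refine (Finsupp.linearCombination_single (A K) 1 c).trans ?_
    rw [AddEquiv.apply_symm_apply, one_smul]
    rfl
  right_inv a := by
    ext c
    refine (congr_arg (toKMod K).symm (Finsupp.linearCombination_single (A K) 1 c)).trans ?_
    simp

theorem linearYonedaObj_d_eq_zero (i j : ℕ) :
    ((resComplex K).linearYonedaObj K (KMod K)).d i j = 0 := by
  by_cases hij : i + 1 = j
  · subst hij
    ext φ
    change (resComplex K).d (i + 1) i ≫ φ = 0
    rw [resComplex_d]
    exact ModuleCat.hom_ext (linearMap_comp_bdry K φ.hom)
  · exact HomologicalComplex.shape _ _ _ hij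

/-- The minimal resolution identifies `Ext` with functions on chains. -/
theorem finrank_extKK (k : ℕ) : Module.finrank K (extKK K k) = (chains k).toFinset.card := by
  have := HomologicalComplex.isIso_iCycles ((resComplex K).linearYonedaObj K (KMod K)) k _ rfl
    (linearYonedaObj_d_eq_zero K _ _)
  have := HomologicalComplex.isIso_homologyπ ((resComplex K).linearYonedaObj K (KMod K)) _ k rfl
    (linearYonedaObj_d_eq_zero K _ _)
  have e : extKK K k ≅ ((resComplex K).linearYonedaObj K (KMod K)).X k :=
    (resolution K).isoExt k (KMod K) ≪≫
      (asIso (((resComplex K).linearYonedaObj K (KMod K)).homologyπ k)).symm ≪≫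
      asIso (((resComplex K).linearYonedaObj K (KMod K)).iCycles k)
  have : Fintype (Chain k) := Fintype.subtype (chains k).toFinset (by simp)
  rw [(e.toLinearEquiv.trans (homEquiv K k)).finrank_eq, Module.finrank_fintype_fun_eq_card]
  exact Fintype.card_of_subtype _ (by simp)

/-- The total dimension of the Yoneda algebra of `A` is `39`:
the sum over all `n ≥ 0` of `dim_K Extᴬⁿ(K,K)` equals
`1 + 13 + 9 + 8 + 4 + 3 + 1 = 39`. -/
theorem statement_15 : ∑' n : ℕ, Module.finrank K (extKK K n) = 39 := by
  rw [tsum_eq_sum (s := Finset.range 7) fun k hk => ?_]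
  · simp only [finrank_extKK, sum_card_chains]
  · obtain ⟨j, rfl⟩ := Nat.exists_eq_add_of_le' (not_lt.1 (Finset.mem_range.not.1 hk))
    rw [finrank_extKK, chains_add_seven]
    rfl
end
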